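/- There do not exist a finite two-graph C, four distinct vertices a, b, c, d of C, and an automorphism g of C such that {a,b,c} is not a hyperedge of C, {a,b,d} is a hyperedge of C, g(a) = b, g(b) = a, g(c) = c, and g(d) = d. (Consequently, the class of finite two-graphs does not have the amalgamation property with automorphisms.) -/

import Mathlib

open scoped Classical in
/-- Classical indicator of a proposition. -/
noncomputable def indic (P : Prop) : ℕ := if P then 1 else 0

/-- The three-element set `{a, b, c}` (as a `Finset`), defined classically. -/
noncomputable def tri {V : Type} (a b c : V) : Finset V :=
  letI := Classical.decEq V
  {a, b, c}

/-- A two-graph: a set of 3-element hyperedges such that every four distinct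
vertices carry an even number of hyperedges. -/
def IsTwoGraph {V : Type} (T : Finset (Finset V)) : Prop :=
  (∀ t ∈ T, t.card = 3) ∧
  ∀ a b c d : V, a ≠ b → a ≠ c → a ≠ d → b ≠ c → b ≠ d → c ≠ d →
    Even (indic (tri a b c ∈ T) + indic (tri a b d ∈ T) +
      indic (tri a c d ∈ T) + indic (tri b c d ∈ T))

/-- Failure of APA for two-graphs: there is no finite two-graph `C` with four
distinct vertices `a, b, c, d` and an automorphism `g` swapping `a` and `b`
and fixing `c` and `d` such that `{a,b,c}` is a non-hyperedge and `{a,b,d}` is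
a hyperedge. -/
theorem twographs_no_APA :
    ¬ ∃ (V : Type) (_ : Fintype V) (T : Finset (Finset V))
        (a b c d : V) (g : Equiv.Perm V),
        IsTwoGraph T ∧
        (a ≠ b ∧ a ≠ c ∧ a ≠ d ∧ b ≠ c ∧ b ≠ d ∧ c ≠ d) ∧
        (∀ x y z : V, tri (g x) (g y) (g z) ∈ T ↔ tri x y z ∈ T) ∧
        tri a b c ∉ T ∧ tri a b d ∈ T ∧
        g a = b ∧ g b = a ∧ g c = c ∧ g d = d := by
  rintro ⟨V, _, T, a, b, c, d, g, ⟨-, hT⟩, ⟨hab, hac, had, hbc, hbd, hcd⟩, hg, habc, habd,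
    hga, -, hgc, hgd⟩
  have hswap := hg a c d
  rw [hga, hgc, hgd] at hswap
  have heven := hT a b c d hab hac had hbc hbd hcd
  simp only [indic, habc, habd, hswap, if_true, if_false] at heven
  grind
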